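/- arXiv:2506.08808 — 2 statements merged into one kernel-verified Lean document; each statement's English description precedes it below -/
import Mathlib

section
/- Let E be a real Banach space, Y a closed convex subset of E, and U an open subset of Y (in the subspace topology of Y) with 0 ∈ U. Let η > 1 be a real number and let S : cl(U) → E be a continuous map (cl(U) denotes the closure of U) such that: (i) the image (I − S)(cl(U)) is contained in a compact subset of Y, and (ii) there is no x in the boundary of U relative to Y and no λ ∈ (0, 1/η) with x = λ(I − S)x. Then there exists x ∈ cl(U) such that η·x + S x = x, i.e., the map T + S with T x = η·x has at least one fixed point in cl(U). -/
section Scarf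

variable {I P L : Type*} [LinearOrder L]

/-- A finite set `X` is dominant for the orders induced by the keys `r i` if no point lies
strictly above the minimum of `X` in all of these orders simultaneously. -/
def IsDominant (r : I → P → L) (X : Finset P) : Prop :=
  ∀ y, ∃ i, ∀ x ∈ X, r i y ≤ r i x

variable [Fintype I] [DecidableEq I] [DecidableEq P] {r : I → P → L}

/-- A dominant set with one element fewer than there are orders extends by a single point to a
dominant set in exactly two ways, unless it consists of slack points. -/
theorem IsDominant.exists_pair_insert [Fintype P] (hr : ∀ i, Function.Injective (r i))
    {s : I → P} {X : Finset P} (hX : IsDominant r X) (hcard : X.card + 1 = Fintype.card I)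
    (hs : ∃ t ∈ X, ∀ i j, j ≠ i → r i t < r i (s j)) :
    ∃ u v, u ≠ v ∧ ∀ z, (z ∉ X ∧ IsDominant r (insert z X)) ↔ z = u ∨ z = v := by
  obtain ⟨t, htX, ht⟩ := hs
  have hmin : ∀ i, ∃ x ∈ X, ∀ y ∈ X, r i x ≤ r i y := fun i =>
    X.exists_min_image (r i) ⟨t, htX⟩
  choose m hmX hm using hmin
  have hsurj : ∀ x ∈ X, ∃ i, m i = x := by
    intro x hx
    obtain ⟨i, hi⟩ := hX x
    exact ⟨i, hr i (le_antisymm (hm i x hx) (hi _ (hmX i)))⟩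
  obtain ⟨a, -, b, -, hab, hmab⟩ := Finset.exists_ne_map_eq_of_card_lt_of_maps_to
    (s := (Finset.univ : Finset I)) (t := X) (f := m)
    (by rw [Finset.card_univ]; omega) (fun i _ => hmX i)
  have hinj : ∀ k l, k ≠ l → m k = m l → ∀ i j, i ≠ k → j ≠ k → m i = m j → i = j := by
    intro k l hkl hmkl i j hi hj hij
    refine Finset.injOn_of_surjOn_of_card_le (s := Finset.univ.erase k) (t := X) m
      (fun i _ => hmX i) ?_ ?_ (by simpa using hi) (by simpa using hj) hij
    · intro x hx
      obtain ⟨i, rfl⟩ := hsurj x hx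
      by_cases hik : i = k
      · exact ⟨l, by simpa using hkl.symm, by rw [hik, hmkl]⟩
      · exact ⟨i, by simpa using hik, rfl⟩
    · rw [Finset.card_erase_of_mem (Finset.mem_univ _), Finset.card_univ]; omega
  have hpair : ∀ i j, i ≠ j → m i = m j → (i = a ∧ j = b) ∨ (i = b ∧ j = a) := by
    intro i j hij hmij
    have h1 := hinj a b hab hmab i j
    have h2 := hinj b a hab.symm hmab.symm i j
    grind
  have hmax : ∀ k, ∃ z, (∀ i, i ≠ k → r i (m i) < r i z) ∧
      ∀ z', (∀ i, i ≠ k → r i (m i) < r i z') → r k z' ≤ r k z := by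
    intro k
    obtain ⟨z, hz, hz'⟩ := (Finset.univ.filter
      fun z => ∀ i, i ≠ k → r i (m i) < r i z).exists_max_image (r k)
      ⟨s k, by simpa using fun i hi => (hm i t htX).trans_lt (ht i k (Ne.symm hi))⟩
    exact ⟨z, by simpa using hz, fun z' h => hz' z' (by simpa using h)⟩
  choose w hw hwmax using hmax
  have hlow : ∀ k l, k ≠ l → m k = m l → r k (w k) < r k (m k) := by
    intro k l hkl hmkl
    obtain ⟨i, hi⟩ := hX (w k)
    have hik : i = k := by
      by_contra h
      exact absurd (hw k i h) (not_lt.2 (hi _ (hmX i)))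
    subst hik
    refine lt_of_le_of_ne (hi _ (hmX i)) fun h => ?_
    have h1 := hw i l hkl.symm
    rw [hr i h, hmkl] at h1
    exact lt_irrefl _ h1
  have hroom : ∀ k l, k ≠ l → m k = m l → w k ∉ X ∧ IsDominant r (insert (w k) X) := by
    intro k l hkl hmkl
    have hk := hlow k l hkl hmkl
    refine ⟨fun h => absurd (hm k _ h) (not_le.2 hk), fun y => ?_⟩
    by_contra! hy
    have hyM : ∀ i, i ≠ k → r i (m i) < r i y := by
      intro i hi
      obtain ⟨x, hx, hxy⟩ := hy i
      rcases Finset.mem_insert.1 hx with rfl | hx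
      · exact (hw k i hi).trans hxy
      · exact (hm i x hx).trans_lt hxy
    have hyw := hwmax k y hyM
    obtain ⟨x, hx, hxy⟩ := hy k
    rcases Finset.mem_insert.1 hx with rfl | hx
    · exact absurd hyw (not_le.2 hxy)
    · exact absurd ((hm k x hx).trans_lt hxy) (not_lt.2 (hyw.trans hk.le))
  refine ⟨w a, w b, fun h => ?_, fun z => ⟨fun ⟨hzX, hz⟩ => ?_, ?_⟩⟩
  · have h1 := hlow a b hab hmab
    have h2 := hw b a hab
    rw [h] at h1
    exact lt_asymm h1 h2
  · obtain ⟨k, hk⟩ := hz z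
    have hother : ∀ x ∈ X, ∃ i, i ≠ k ∧ m i = x ∧ r i x < r i z := by
      intro x hx
      obtain ⟨i, hi⟩ := hz x
      have hlt : r i x < r i z := lt_of_le_of_ne (hi z (Finset.mem_insert_self _ _))
        fun h => hzX (hr i h ▸ hx)
      refine ⟨i, ?_, hr i (le_antisymm (hm i x hx) (hi _ (Finset.mem_insert_of_mem (hmX i)))), hlt⟩
      rintro rfl
      exact absurd (hk x (Finset.mem_insert_of_mem hx)) (not_le.2 hlt)
    have hkab : k = a ∨ k = b := by
      obtain ⟨i, hik, hi, -⟩ := hother (m k) (hmX k)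
      have := hpair i k hik hi
      tauto
    have hzM : ∀ i, i ≠ k → r i (m i) < r i z := by
      intro i hi
      obtain ⟨j, hjk, hj, hlt⟩ := hother (m i) (hmX i)
      by_cases hij : i = j
      · rwa [hij] at hlt ⊢
      · have := hpair j i (Ne.symm hij) hj
        grind
    have hzw : z = w k := by
      obtain ⟨i, hi⟩ := hz (w k)
      have hik : i = k := by
        by_contra h
        exact absurd (hw k i h) (not_lt.2 (hi _ (Finset.mem_insert_of_mem (hmX i))))
      subst hik
      exact hr i (le_antisymm (hwmax i z hzM) (hi z (Finset.mem_insert_self _ _)))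
    rcases hkab with rfl | rfl
    · exact Or.inl hzw
    · exact Or.inr hzw
  · rintro (rfl | rfl)
    · exact hroom a b hab hmab
    · exact hroom b a hab.symm hmab.symm

/-- The set of all slack points but one extends by a single point to a dominant set in exactly
one way. -/
theorem existsUnique_insert_isDominant [Fintype P] (hr : ∀ i, Function.Injective (r i))
    {s : I → P} (hbot : ∀ i p, r i (s i) ≤ r i p)
    (htop : ∀ i j p, p ∉ Set.range s → j ≠ i → r i p < r i (s j))
    (hne : ∃ p, p ∉ Set.range s) (k : I) :
    ∃! z, z ∉ (Finset.univ.erase k).image s ∧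
      IsDominant r (insert z ((Finset.univ.erase k).image s)) := by
  classical
  obtain ⟨t, ht, htmax⟩ := (Finset.univ.filter fun p => p ∉ Set.range s).exists_max_image (r k)
    (by obtain ⟨p, hp⟩ := hne; exact ⟨p, by simpa using hp⟩)
  have ht : t ∉ Set.range s := (Finset.mem_filter.1 ht).2
  have htmax : ∀ p, p ∉ Set.range s → r k p ≤ r k t := fun p hp =>
    htmax p (Finset.mem_filter.2 ⟨Finset.mem_univ _, hp⟩)
  have hlt : ∀ i, r i (s i) < r i t := fun i =>
    lt_of_le_of_ne (hbot i t) fun h => ht ⟨i, hr i h⟩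
  refine ⟨t, ⟨fun h => ?_, fun y => ?_⟩, fun z ⟨hz, hdom⟩ => ?_⟩
  · obtain ⟨i, -, rfl⟩ := Finset.mem_image.1 h
    exact ht ⟨i, rfl⟩
  · by_cases hy : y ∈ Set.range s
    · obtain ⟨j, rfl⟩ := hy
      exact ⟨j, fun x _ => hbot j x⟩
    · refine ⟨k, fun x hx => ?_⟩
      rcases Finset.mem_insert.1 hx with rfl | hx
      · exact htmax y hy
      · obtain ⟨j, hj, rfl⟩ := Finset.mem_image.1 hx
        exact (htop k j y hy (by simpa using hj)).le
  · obtain ⟨i, hi⟩ := hdom t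
    have hik : i = k := by
      by_contra h
      exact absurd (hlt i) (not_lt.2 (hi (s i) (Finset.mem_insert_of_mem
        (Finset.mem_image_of_mem _ (by simpa using h)))))
    subst hik
    have hzt := hi z (Finset.mem_insert_self _ _)
    by_cases hzs : z ∈ Set.range s
    · obtain ⟨j, rfl⟩ := hzs
      have hj : j = i := by
        by_contra h
        exact hz (Finset.mem_image_of_mem _ (by simpa using h))
      subst hj
      exact absurd (hlt j) (not_lt.2 hzt)
    · exact hr i (le_antisymm (htmax z hzs) hzt)

theorem even_card_filter_image_erase {c : P → I} {Y : Finset P}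
    (hcard : Y.card = Fintype.card I) (hY : Y.image c ≠ Finset.univ) (k : I) :
    Even (Y.filter fun z => (Y.erase z).image c = Finset.univ.erase k).card := by
  rcases (Y.filter fun z => (Y.erase z).image c = Finset.univ.erase k).eq_empty_or_nonempty
    with h | ⟨z, hz⟩
  · simp [h]
  obtain ⟨hzY, hz⟩ := Finset.mem_filter.1 hz
  have hinj : Set.InjOn c (Y.erase z) := by
    rw [← Finset.card_image_iff, hz, Finset.card_erase_of_mem hzY,
      Finset.card_erase_of_mem (Finset.mem_univ _), hcard, Finset.card_univ]
  have hmem : ∀ i, i ≠ k → ∃ u ∈ Y, u ≠ z ∧ c u = i := by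
    intro i hi
    have : i ∈ (Y.erase z).image c := by rw [hz]; simpa using hi
    obtain ⟨u, hu, rfl⟩ := Finset.mem_image.1 this
    exact ⟨u, Finset.mem_of_mem_erase hu, Finset.ne_of_mem_erase hu, rfl⟩
  have hne : ∀ u ∈ Y, u ≠ z → c u ≠ k := by
    intro u hu huz
    have : c u ∈ (Y.erase z).image c := Finset.mem_image_of_mem _ (by simp [hu, huz])
    rw [hz] at this
    exact Finset.ne_of_mem_erase this
  have hzk : c z ≠ k := by
    intro h
    refine hY (Finset.eq_univ_of_forall fun i => ?_)
    by_cases hi : i = k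
    · exact Finset.mem_image.2 ⟨z, hzY, h.trans hi.symm⟩
    · obtain ⟨u, hu, -, rfl⟩ := hmem i hi
      exact Finset.mem_image_of_mem _ hu
  obtain ⟨w, hwY, hwz, hcw⟩ := hmem (c z) hzk
  have hinj' : ∀ u ∈ Y, ∀ v ∈ Y, u ≠ z → v ≠ z → c u = c v → u = v :=
    fun u hu v hv huz hvz h => hinj (by simp [hu, huz]) (by simp [hv, hvz]) h
  have : (Y.filter fun z => (Y.erase z).image c = Finset.univ.erase k) = {z, w} := by
    ext v
    simp only [Finset.mem_filter, Finset.mem_insert, Finset.mem_singleton]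
    constructor
    · rintro ⟨hv, hve⟩
      by_contra! hvzw
      have : c v ∈ (Y.erase v).image c := by rw [hve]; simpa using hne v hv hvzw.1
      obtain ⟨u, hu, hcu⟩ := Finset.mem_image.1 this
      have := hinj' u (Finset.mem_of_mem_erase hu) v hv
      have := hinj' v hv w hwY
      have := Finset.ne_of_mem_erase hu
      grind
    · rintro (rfl | rfl)
      · exact ⟨hzY, hz⟩
      · refine ⟨hwY, ?_⟩
        ext i
        simp only [Finset.mem_image, Finset.mem_erase, Finset.mem_univ, and_true]
        constructor
        · rintro ⟨u, ⟨-, hu⟩, rfl⟩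
          by_cases huz : u = z
          · rwa [huz]
          · exact hne u hu huz
        · intro hi
          obtain ⟨u, hu, huz, hcu⟩ := hmem i hi
          by_cases huv : u = v
          · exact ⟨z, ⟨fun h => hwz h.symm, hzY⟩, by rw [← hcw, ← huv, hcu]⟩
          · exact ⟨u, ⟨huv, hu⟩, hcu⟩
  rw [this, Finset.card_pair hwz.symm]
  exact even_two

/-- **Scarf's lemma**: a colouring that gives each slack point `s i` the colour `i` admits a
dominant set carrying all colours. -/
theorem exists_isDominant_image_eq_univ [Fintype P] [Nonempty I]
    (hr : ∀ i, Function.Injective (r i)) {s : I → P} (hbot : ∀ i p, r i (s i) ≤ r i p)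
    (htop : ∀ i j p, p ∉ Set.range s → j ≠ i → r i p < r i (s j))
    (hne : ∃ p, p ∉ Set.range s) (c : P → I) (hc : ∀ i, c (s i) = i) :
    ∃ X : Finset P, IsDominant r X ∧ X.image c = Finset.univ := by
  classical
  by_contra! hno
  let k : I := Classical.arbitrary I
  let F : Finset (Finset P × P) := Finset.univ.filter fun q =>
    q.2 ∉ q.1 ∧ q.1.card + 1 = Fintype.card I ∧ IsDominant r (insert q.2 q.1) ∧
      q.1.image c = Finset.univ.erase k
  have hF : ∀ X z, (X, z) ∈ F ↔ z ∉ X ∧ X.card + 1 = Fintype.card I ∧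
      IsDominant r (insert z X) ∧ X.image c = Finset.univ.erase k := fun X z => by
    simp [F]
  have heven : Even F.card := by
    rw [Finset.card_eq_sum_card_image (fun q => insert q.2 q.1) F, even_iff_two_dvd]
    refine Finset.dvd_sum fun Y hY => ?_
    obtain ⟨⟨X, z⟩, hq, rfl⟩ := Finset.mem_image.1 hY
    obtain ⟨hzX, hcard, hdom, -⟩ := (hF X z).1 hq
    have hYcard : (insert z X).card = Fintype.card I := by
      rw [Finset.card_insert_of_notMem hzX, hcard]
    rw [← even_iff_two_dvd]
    suffices hfib : (F.filter fun q => insert q.2 q.1 = insert z X).card = ((insert z X).filter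
        fun v => ((insert z X).erase v).image c = Finset.univ.erase k).card by
      rw [hfib]
      exact even_card_filter_image_erase hYcard (hno _ hdom) k
    refine Finset.card_bij (fun q _ => q.2) ?_ ?_ ?_
    · rintro ⟨X', z'⟩ h
      obtain ⟨h1, h2⟩ := Finset.mem_filter.1 h
      obtain ⟨h3, -, -, h4⟩ := (hF X' z').1 h1
      simp only at h2
      simp [← h2, Finset.erase_insert h3, h4]
    · rintro ⟨X', z'⟩ h ⟨X'', z''⟩ h' rfl
      obtain ⟨h1, h2⟩ := Finset.mem_filter.1 h
      obtain ⟨h1', h2'⟩ := Finset.mem_filter.1 h'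
      simp only at h2 h2'
      rw [← Finset.erase_insert ((hF _ _).1 h1).1, ← Finset.erase_insert ((hF _ _).1 h1').1,
        h2, h2']
    · intro v hv
      obtain ⟨hv, hve⟩ := Finset.mem_filter.1 hv
      refine ⟨((insert z X).erase v, v),
        Finset.mem_filter.2 ⟨(hF _ _).2 ⟨by simp, ?_, ?_, hve⟩, ?_⟩, rfl⟩
      · rw [Finset.card_erase_add_one hv, hYcard]
      · rwa [Finset.insert_erase hv]
      · exact Finset.insert_erase hv
  have hodd : Odd F.card := by
    have hsinj : Function.Injective s := fun i j h => by rw [← hc i, h, hc]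
    let X₀ : Finset P := (Finset.univ.erase k).image s
    have hfib : ∀ X, (F.filter fun q => q.1 = X).card =
        ((Finset.univ : Finset P).filter fun z => (X, z) ∈ F).card := by
      intro X
      refine Finset.card_bij (fun q _ => q.2) ?_ ?_ ?_
      · rintro ⟨X', z⟩ h
        obtain ⟨h1, rfl⟩ := Finset.mem_filter.1 h
        simpa using h1
      · rintro ⟨X', z'⟩ h ⟨X'', z''⟩ h' rfl
        exact Prod.ext ((Finset.mem_filter.1 h).2.trans (Finset.mem_filter.1 h').2.symm) rfl
      · intro z hz
        exact ⟨(X, z), Finset.mem_filter.2 ⟨(Finset.mem_filter.1 hz).2, rfl⟩, rfl⟩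
    have hX₀card : X₀.card + 1 = Fintype.card I := by
      rw [Finset.card_image_of_injective _ hsinj, Finset.card_erase_add_one (Finset.mem_univ _),
        Finset.card_univ]
    have hX₀im : X₀.image c = Finset.univ.erase k := by
      rw [Finset.image_image, show c ∘ s = id from funext hc, Finset.image_id]
    obtain ⟨z₀, hz₀, hz₀u⟩ := existsUnique_insert_isDominant hr hbot htop hne k
    have hz₀F : (X₀, z₀) ∈ F := (hF _ _).2 ⟨hz₀.1, hX₀card, hz₀.2, hX₀im⟩
    rw [Finset.card_eq_sum_card_image Prod.fst F,
      ← Finset.add_sum_erase _ _ (Finset.mem_image_of_mem Prod.fst hz₀F)]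
    refine Odd.add_even ?_ ?_
    · rw [hfib, Finset.card_eq_one.2 ⟨z₀, ?_⟩]
      · exact odd_one
      · ext z
        simp only [Finset.mem_filter, Finset.mem_univ, true_and, Finset.mem_singleton]
        refine ⟨fun h => ?_, fun h => h ▸ hz₀F⟩
        obtain ⟨h1, -, h2, -⟩ := (hF _ _).1 h
        exact hz₀u z ⟨h1, h2⟩
    · rw [even_iff_two_dvd]
      refine Finset.dvd_sum fun X hX => ?_
      obtain ⟨hXX₀, hX⟩ := Finset.mem_erase.1 hX
      obtain ⟨⟨X', z⟩, hq, rfl⟩ := Finset.mem_image.1 hX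
      obtain ⟨-, hcard, hdom, him⟩ := (hF X' z).1 hq
      have hXs : ∃ t ∈ X', t ∉ Set.range s := by
        by_contra! hall
        refine hXX₀ (Finset.eq_of_subset_of_card_le (fun x hx => ?_) (by simp only; omega))
        obtain ⟨i, rfl⟩ := hall x hx
        refine Finset.mem_image_of_mem _ (him ▸ ?_)
        exact Finset.mem_image.2 ⟨s i, hx, hc i⟩
      obtain ⟨t, htX, ht⟩ := hXs
      have hdom' : IsDominant r X' := fun y =>
        (hdom y).imp fun i hi x hx => hi x (Finset.mem_insert_of_mem hx)
      obtain ⟨u, v, huv, h⟩ := hdom'.exists_pair_insert hr hcard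
        ⟨t, htX, fun i j hij => htop i j t ht hij⟩
      have : ((Finset.univ : Finset P).filter fun z => (X', z) ∈ F) = {u, v} := by
        ext z
        simp only [Finset.mem_filter, Finset.mem_univ, true_and, Finset.mem_insert,
          Finset.mem_singleton, ← h, hF, hcard, him, and_true]
      rw [hfib, this, Finset.card_pair huv]
  exact (Nat.not_even_iff_odd.2 hodd) heven

end Scarf

section FixedPoint

/-- A Sperner-type lemma on the grid points of the simplex: every colouring has, in a cluster of
grid points of diameter at most the number of colours, all colours except possibly some whose
coordinate is small on the cluster. -/
theorem exists_cluster_piAntidiag {I : Type*} [Fintype I] [DecidableEq I] [Nonempty I] (N : ℕ)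
    (c : (I → ℕ) → I) :
    ∃ σ : Set (I → ℕ), σ.Nonempty ∧ (∀ t ∈ σ, ∑ i, t i = N) ∧
      (∀ t ∈ σ, ∀ t' ∈ σ, ∀ i, t i ≤ t' i + Fintype.card I) ∧
      ∀ i, (∃ t ∈ σ, c t = i) ∨ ∀ t ∈ σ, t i ≤ Fintype.card I := by
  let T := {t : I → ℕ // t ∈ Finset.piAntidiag Finset.univ N}
  let _ : Fintype T := Finset.Subtype.fintype _
  have hT : ∀ t : T, ∑ i, t.1 i = N := fun t => (Finset.mem_piAntidiag.1 t.2).1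
  have hT' : ∀ t : I → ℕ, ∑ i, t i = N → t ∈ Finset.piAntidiag Finset.univ N := fun t h =>
    Finset.mem_piAntidiag.2 ⟨h, fun i _ => Finset.mem_univ i⟩
  let h : I → T ⊕ I → ℕ := fun i =>
    Sum.elim (fun t => t.1 i + 1) fun j => if j = i then 0 else N + 2
  let e : T ⊕ I ≃ Fin (Fintype.card (T ⊕ I)) := Fintype.equivFin _
  let r : I → T ⊕ I → ℕ ×ₗ Fin (Fintype.card (T ⊕ I)) := fun i p => toLex (h i p, e p)
  have hlt : ∀ i p q, h i p < h i q → r i p < r i q := fun i p q hpq =>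
    Prod.Lex.toLex_lt_toLex.2 (Or.inl hpq)
  have hle : ∀ i p q, r i p ≤ r i q → h i p ≤ h i q := fun i p q hpq => by
    by_contra hc
    exact absurd (hlt i q p (not_le.1 hc)) (not_lt.2 hpq)
  have hr : ∀ i, Function.Injective (r i) := fun i p q hpq =>
    e.injective (congrArg (fun x => (ofLex x).2) hpq)
  have htle : ∀ (t : T) i, t.1 i ≤ N := fun t i =>
    (Finset.single_le_sum (fun _ _ => Nat.zero_le _) (Finset.mem_univ i)).trans (hT t).le
  have hbot : ∀ i p, r i (Sum.inr i) ≤ r i p := by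
    rintro i (t | j)
    · exact (hlt _ _ _ (by simp [h])).le
    · by_cases hj : j = i
      · rw [hj]
      · exact (hlt _ _ _ (by simp [h, hj])).le
  have htop : ∀ i j p, p ∉ Set.range (Sum.inr : I → T ⊕ I) → j ≠ i → r i p < r i (Sum.inr j) := by
    rintro i j (t | l) hp hj
    · refine hlt _ _ _ ?_
      have := htle t i
      simp only [h, Sum.elim_inl, Sum.elim_inr, hj, if_false]
      omega
    · exact absurd ⟨l, rfl⟩ hp
  let t₀ : T := ⟨Pi.single (Classical.arbitrary I) N, hT' _ (by simp)⟩
  obtain ⟨X, hX, hXc⟩ := exists_isDominant_image_eq_univ hr hbot htop ⟨Sum.inl t₀, by simp⟩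
    (Sum.elim (fun t => c t.1) id) (fun i => rfl)
  have hcol : ∀ i, Sum.inr i ∈ X ∨ ∃ t : T, Sum.inl t ∈ X ∧ c t.1 = i := by
    intro i
    obtain ⟨p, hp, hpi⟩ := Finset.mem_image.1 (hXc ▸ Finset.mem_univ i)
    rcases p with t | j
    · exact Or.inr ⟨t, hp, hpi⟩
    · obtain rfl : j = i := hpi
      exact Or.inl hp
  have hdom : ∀ t : T, ∃ i, Sum.inr i ∉ X ∧ ∀ t' : T, Sum.inl t' ∈ X → t.1 i ≤ t'.1 i := by
    intro t
    obtain ⟨i, hi⟩ := hX (Sum.inl t)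
    refine ⟨i, fun hiX => ?_, fun t' ht' => ?_⟩
    · simpa [h] using hle _ _ _ (hi _ hiX)
    · simpa [h] using hle _ _ _ (hi _ ht')
  obtain ⟨i₁, hi₁, -⟩ := hdom t₀
  obtain ⟨t₁, ht₁, -⟩ := (hcol i₁).resolve_left hi₁
  have hmin : ∀ i, ∃ t : T, Sum.inl t ∈ X ∧ ∀ t' : T, Sum.inl t' ∈ X → t.1 i ≤ t'.1 i := by
    intro i
    obtain ⟨t, ht, htm⟩ := (Finset.univ.filter fun t : T => Sum.inl t ∈ X).exists_min_image
      (fun t => t.1 i) ⟨t₁, by simpa using ht₁⟩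
    exact ⟨t, by simpa using ht, fun t' ht' => htm t' (by simpa using ht')⟩
  choose m hmX hm using hmin
  let M : I → ℕ := fun i => if Sum.inr i ∈ X then 0 else (m i).1 i
  let M' : I → ℕ := fun i => if Sum.inr i ∈ X then 0 else (m i).1 i + 1
  have hMt : ∀ t : T, Sum.inl t ∈ X → ∀ i, M i ≤ t.1 i := by
    intro t ht i
    simp only [M]
    split_ifs
    · exact Nat.zero_le _
    · exact hm i t ht
  have hsum' : N < ∑ i, M' i := by
    by_contra! hN
    obtain ⟨i, hi, hit⟩ := hdom ⟨M' + Pi.single i₁ (N - ∑ i, M' i), hT' _ (by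
      simp only [Pi.add_apply, Finset.sum_add_distrib, Finset.sum_pi_single', Finset.mem_univ,
        if_true]
      omega)⟩
    have h1 := hit (m i) (hmX i)
    simp only [Pi.add_apply, M', hi, if_false] at h1
    omega
  have hsum : N ≤ ∑ i, M i + Fintype.card I := by
    have : ∑ i, M' i ≤ ∑ i, (M i + 1) := Finset.sum_le_sum fun i _ => by
      simp only [M, M']
      split_ifs <;> omega
    rw [Finset.sum_add_distrib, Finset.sum_const, Finset.card_univ, smul_eq_mul, mul_one] at this
    omega
  have hup : ∀ t : T, Sum.inl t ∈ X → ∀ i, t.1 i ≤ M i + Fintype.card I := by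
    intro t ht i
    have h1 : ∑ j, t.1 j = ∑ j, M j + ∑ j, (t.1 j - M j) := by
      rw [← Finset.sum_add_distrib]
      exact Finset.sum_congr rfl fun j _ => (Nat.add_sub_cancel' (hMt t ht j)).symm
    have h2 : t.1 i - M i ≤ ∑ j, (t.1 j - M j) :=
      Finset.single_le_sum (f := fun j => t.1 j - M j) (fun _ _ => Nat.zero_le _)
        (Finset.mem_univ i)
    have := hT t
    omega
  refine ⟨{t | ∃ t' : T, Sum.inl t' ∈ X ∧ t'.1 = t}, ⟨_, t₁, ht₁, rfl⟩, ?_, ?_, fun i => ?_⟩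
  · rintro _ ⟨t, -, rfl⟩
    exact hT t
  · rintro _ ⟨t, ht, rfl⟩ _ ⟨t', ht', rfl⟩ i
    exact (hup t ht i).trans (by have := hMt t' ht' i; omega)
  · rcases hcol i with hi | ⟨t, ht, hti⟩
    · refine Or.inr ?_
      rintro _ ⟨t, ht, rfl⟩
      have := hup t ht i
      simpa [M, hi] using this
    · exact Or.inl ⟨_, ⟨t, ht, rfl⟩, hti⟩

theorem exists_approx_le_of_mapsTo_stdSimplex {I : Type*} [Fintype I] [Nonempty I]
    {f : (I → ℝ) → I → ℝ} (hf : Set.MapsTo f (stdSimplex ℝ I) (stdSimplex ℝ I)) {δ : ℝ}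
    (hδ : 0 < δ) :
    ∃ x ∈ stdSimplex ℝ I, ∀ i, ∃ y ∈ stdSimplex ℝ I, dist y x ≤ δ ∧ y i ≤ f y i + δ := by
  classical
  obtain ⟨N, hN⟩ := exists_nat_gt ((Fintype.card I : ℝ) / δ)
  have hN0 : (0 : ℝ) < N := lt_of_le_of_lt (by positivity) hN
  have hNδ : (Fintype.card I : ℝ) / N ≤ δ := by
    rw [div_lt_iff₀ hδ] at hN
    rw [div_le_iff₀ hN0]
    linarith
  let g : (I → ℕ) → I → ℝ := fun t i => (t i : ℝ) / N
  have hg : ∀ t : I → ℕ, ∑ i, t i = N → g t ∈ stdSimplex ℝ I := fun t ht =>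
    ⟨fun i => by positivity, by
      simp only [g]
      rw [← Finset.sum_div, ← Nat.cast_sum, ht, div_self hN0.ne']⟩
  have hcol : ∀ t : I → ℕ, ∃ i, ∑ i, t i = N → g t i ≤ f (g t) i := by
    intro t
    by_cases ht : ∑ i, t i = N
    · obtain ⟨i, -, hi⟩ := Finset.exists_le_of_sum_le (s := (Finset.univ : Finset I))
        Finset.univ_nonempty ((hg t ht).2.trans (hf (hg t ht)).2.symm).le
      exact ⟨i, fun _ => hi⟩
    · exact ⟨Classical.arbitrary I, fun h => absurd h ht⟩
  choose c hc using hcol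
  obtain ⟨σ, ⟨t, ht⟩, hsum, hdiam, hσ⟩ := exists_cluster_piAntidiag N c
  refine ⟨g t, hg t (hsum t ht), fun i => ?_⟩
  rcases hσ i with ⟨t', ht', rfl⟩ | hi
  · refine ⟨g t', hg t' (hsum t' ht'), (dist_pi_le_iff hδ.le).2 fun j => le_trans ?_ hNδ, ?_⟩
    · have h1 : (t j : ℝ) ≤ t' j + Fintype.card I := mod_cast hdiam t ht t' ht' j
      have h2 : (t' j : ℝ) ≤ t j + Fintype.card I := mod_cast hdiam t' ht' t ht j
      rw [Real.dist_eq, ← sub_div, abs_div, abs_of_pos hN0]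
      gcongr
      rw [abs_le]
      constructor <;> linarith
    · have := hc t' (hsum t' ht')
      linarith
  · refine ⟨g t, hg t (hsum t ht), by simpa using hδ.le, ?_⟩
    have h1 : (t i : ℝ) ≤ Fintype.card I := mod_cast hi t ht
    have h2 : g t i ≤ (Fintype.card I : ℝ) / N := by
      simp only [g]
      gcongr
    have h3 := (hf (hg t (hsum t ht))).1 i
    linarith

/-- **Brouwer's fixed point theorem** for the standard simplex. -/
theorem exists_fixedPoint_stdSimplex {I : Type*} [Fintype I] [Nonempty I]
    {f : (I → ℝ) → I → ℝ} (hfc : ContinuousOn f (stdSimplex ℝ I))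
    (hf : Set.MapsTo f (stdSimplex ℝ I) (stdSimplex ℝ I)) :
    ∃ x ∈ stdSimplex ℝ I, f x = x := by
  classical
  have hK : IsCompact (stdSimplex ℝ I) := isCompact_stdSimplex ℝ I
  have hfi : ∀ i, ContinuousOn (fun x => f x i) (stdSimplex ℝ I) := fun i =>
    (continuous_apply i).comp_continuousOn hfc
  have hgc : ContinuousOn (fun x => ∑ i, max 0 (x i - f x i)) (stdSimplex ℝ I) :=
    continuousOn_finsetSum _ fun i _ =>
      continuousOn_const.sup ((continuous_apply i).continuousOn.sub (hfi i))
  obtain ⟨x, hx, hmin⟩ := hK.exists_isMinOn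
    ⟨_, single_mem_stdSimplex ℝ (Classical.arbitrary I)⟩ hgc
  have hsmall : ∀ ε > 0, ∑ i, max 0 (x i - f x i) ≤ Fintype.card I * ε := by
    intro ε hε
    obtain ⟨δ, hδ, hunif⟩ := Metric.uniformContinuousOn_iff.1
      (hK.uniformContinuousOn_of_continuous hfc) (ε / 3) (by positivity)
    obtain ⟨z, hz, hzy⟩ := exists_approx_le_of_mapsTo_stdSimplex hf
      (δ := min (δ / 2) (ε / 3)) (by positivity)
    refine (hmin hz).trans ?_
    rw [← nsmul_eq_mul, ← Finset.card_univ, ← Finset.sum_const]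
    refine Finset.sum_le_sum fun i _ => max_le hε.le ?_
    obtain ⟨y, hy, hyz, hyi⟩ := hzy i
    have h1 := (dist_le_pi_dist _ _ i).trans_lt (hunif y hy z hz
      (hyz.trans_lt ((min_le_left _ _).trans_lt (half_lt_self hδ))))
    have h2 := (dist_le_pi_dist _ _ i).trans (hyz.trans (min_le_right _ _))
    have h3 := hyi.trans (add_le_add_right (min_le_right _ _) _)
    rw [Real.dist_eq] at h1 h2
    have := abs_lt.1 h1
    have := abs_le.1 h2
    linarith
  have hzero : ∑ i, max 0 (x i - f x i) ≤ 0 := by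
    refine le_of_forall_pos_le_add fun ε hε => ?_
    have hcard : (0 : ℝ) < Fintype.card I := mod_cast Fintype.card_pos
    have := hsmall (ε / Fintype.card I) (by positivity)
    rwa [mul_div_cancel₀ _ hcard.ne', ← zero_add ε] at this
  have hle : ∀ i, x i ≤ f x i := fun i => by
    have := (Finset.single_le_sum (f := fun i => max 0 (x i - f x i))
      (fun _ _ => le_max_left _ _) (Finset.mem_univ i)).trans hzero
    exact sub_nonpos.1 ((le_max_right _ _).trans this)
  refine ⟨x, hx, funext fun i => ?_⟩
  exact ((Finset.sum_eq_sum_iff_of_le fun i _ => hle i).1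
    (hx.2.trans (hf hx).2.symm) i (Finset.mem_univ i)).symm

/-- **Schauder's fixed point theorem** for compact convex subsets of a normed space. -/
theorem exists_fixedPoint_of_isCompact_convex {E : Type*} [NormedAddCommGroup E]
    [NormedSpace ℝ E] {C : Set E} (hC : IsCompact C) (hconv : Convex ℝ C) (hne : C.Nonempty)
    {f : E → E} (hfc : ContinuousOn f C) (hf : Set.MapsTo f C C) :
    ∃ x ∈ C, f x = x := by
  obtain ⟨x, hx, hmin⟩ := hC.exists_isMinOn hne (hfc.sub continuousOn_id).norm
  refine ⟨x, hx, ?_⟩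
  by_contra hfx
  have hd : 0 < ‖f x - x‖ := norm_pos_iff.2 (sub_ne_zero.2 hfx)
  set d := ‖f x - x‖
  obtain ⟨s, hsC, hsfin, hs⟩ := hC.finite_cover_balls hd
  have := hsfin.fintype
  have hnes : Nonempty s := by
    obtain ⟨p, hp, -⟩ := Set.mem_iUnion₂.1 (hs hx)
    exact ⟨⟨p, hp⟩⟩
  let w : s → E → ℝ := fun p y => max 0 (d - dist y p)
  have hw0 : ∀ p y, 0 ≤ w p y := fun p y => le_max_left _ _
  have hwc : ∀ p, Continuous (w p) := fun p => by fun_prop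
  have hwpos : ∀ y ∈ C, 0 < ∑ p, w p y := by
    intro y hy
    obtain ⟨p, hp, hyp⟩ := Set.mem_iUnion₂.1 (hs hy)
    refine Finset.sum_pos' (fun p _ => hw0 p y) ⟨⟨p, hp⟩, Finset.mem_univ _, ?_⟩
    exact lt_max_of_lt_right (sub_pos.2 hyp)
  let P : E → s → ℝ := fun y p => w p y / ∑ q, w q y
  have hPmem : ∀ y ∈ C, P y ∈ stdSimplex ℝ s := fun y hy =>
    ⟨fun p => div_nonneg (hw0 p y) (hwpos y hy).le, by
      simp only [P]
      rw [← Finset.sum_div, div_self (hwpos y hy).ne']⟩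
  have hPc : ContinuousOn P C := continuousOn_pi.2 fun p =>
    (hwc p).continuousOn.div (continuous_finsetSum _ fun q _ => hwc q).continuousOn
      fun y hy => (hwpos y hy).ne'
  let Q : (s → ℝ) → E := fun a => ∑ p, a p • (p : E)
  have hQc : Continuous Q := by fun_prop
  have hQmem : Set.MapsTo Q (stdSimplex ℝ s) C := fun a ha =>
    hconv.sum_mem (fun p _ => ha.1 p) ha.2 fun p _ => hsC p.2
  obtain ⟨a, ha, hfix⟩ := exists_fixedPoint_stdSimplex (f := fun a => P (f (Q a)))
    (hPc.comp (hfc.comp hQc.continuousOn hQmem) (hf.comp hQmem))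
    (fun a ha => hPmem _ (hf (hQmem ha)))
  have hfQ : f (Q a) ∈ C := hf (hQmem ha)
  have hQa : ∑ p ∈ Finset.univ.filter fun p => a p ≠ 0, a p • (p : E) = Q a :=
    Finset.sum_filter_of_ne fun p _ hp h => hp (by rw [h, zero_smul])
  have hball : Q a ∈ Metric.ball (f (Q a)) d := by
    suffices ∑ p ∈ Finset.univ.filter fun p => a p ≠ 0, a p • (p : E) ∈
        Metric.ball (f (Q a)) d by rwa [hQa] at this
    refine (convex_ball _ _).sum_mem (fun p _ => ha.1 p) ?_ fun p hp => ?_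
    · rw [Finset.sum_filter_ne_zero, ha.2]
    · have hap : a p ≠ 0 := (Finset.mem_filter.1 hp).2
      rw [← hfix] at hap
      have hwp : w p (f (Q a)) ≠ 0 := fun h => hap (by simp only [P, h, zero_div])
      have : 0 < d - dist (f (Q a)) p := by
        by_contra! h
        exact hwp (max_eq_left h)
      rw [Metric.mem_ball, dist_comm]
      linarith
  have h1 : d ≤ ‖f (Q a) - Q a‖ := hmin (hQmem ha)
  rw [Metric.mem_ball, dist_comm, dist_eq_norm] at hball
  exact absurd hball (not_lt.2 h1)

/-- The **Leray–Schauder nonlinear alternative** for compact maps from the closure of a relatively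
open subset `U` of a closed convex set `Y` into `Y`. -/
theorem exists_fixedPoint_or_exists_eq_smul {E : Type*} [NormedAddCommGroup E] [NormedSpace ℝ E]
    [CompleteSpace E] {Y U V K : Set E} (hY : IsClosed Y) (hYconv : Convex ℝ Y) (hV : IsOpen V)
    (hU : U = V ∩ Y) (h0 : (0 : E) ∈ U) (hK : IsCompact K) (hKY : K ⊆ Y) {f : E → E}
    (hfc : ContinuousOn f (closure U)) (hf : Set.MapsTo f (closure U) K) :
    (∃ x ∈ closure U, f x = x) ∨
      ∃ x ∈ closure U \ U, ∃ t : ℝ, 0 < t ∧ t < 1 ∧ x = t • f x := by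
  classical
  by_contra! h
  obtain ⟨hno, hbd⟩ := h
  have hUY : closure U ⊆ Y := closure_minimal (hU ▸ Set.inter_subset_right) hY
  have h0Y : (0 : E) ∈ Y := hUY (subset_closure h0)
  have hdiff : closure U \ U = closure U ∩ Vᶜ := by
    ext x
    constructor
    · rintro ⟨hx, hxU⟩
      exact ⟨hx, fun hxV => hxU (hU ▸ ⟨hxV, hUY hx⟩)⟩
    · rintro ⟨hx, hxV⟩
      exact ⟨hx, fun hxU => hxV (hU ▸ hxU : x ∈ V ∩ Y).1⟩
  let A : Set E := Prod.snd '' {p : Set.Icc (0 : ℝ) 1 × E |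
    p.2 ∈ closure U ∧ p.2 - (p.1 : ℝ) • f p.2 = 0}
  have hA : IsClosed A := by
    refine isClosedMap_snd_of_compactSpace _ ?_
    have hcont : ContinuousOn (fun p : Set.Icc (0 : ℝ) 1 × E => p.2 - (p.1 : ℝ) • f p.2)
        (Prod.snd ⁻¹' closure U) :=
      continuous_snd.continuousOn.sub
        ((continuous_subtype_val.comp continuous_fst).continuousOn.smul
        (hfc.comp continuous_snd.continuousOn fun _ hp => hp))
    exact hcont.preimage_isClosed_of_isClosed (isClosed_closure.preimage continuous_snd)
      (isClosed_singleton (x := (0 : E)))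
  have hdisj : Disjoint (closure U \ U) A := by
    rw [Set.disjoint_left]
    rintro x hx ⟨⟨⟨t, ht0, ht1⟩, _⟩, ⟨-, hxt⟩, rfl⟩
    simp only [sub_eq_zero] at hxt hx
    rcases ht0.eq_or_lt with rfl | ht0
    · rw [zero_smul] at hxt
      exact hx.2 (hxt ▸ h0)
    rcases ht1.eq_or_lt with rfl | ht1
    · rw [one_smul] at hxt
      exact hno _ hx.1 hxt.symm
    · exact hbd _ hx t ht0 ht1 hxt
  obtain ⟨φ, hφ0, hφ1, hφ⟩ := exists_continuous_zero_one_of_isClosed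
    (hdiff ▸ isClosed_closure.inter hV.isClosed_compl) hA hdisj
  let g : E → E := fun x => if x ∈ closure U then φ x • f x else 0
  have hgU : ∀ x ∈ closure U, g x = φ x • f x := fun x hx => if_pos hx
  have hgV : ∀ x ∈ Y ∩ Vᶜ, g x = 0 := by
    intro x hx
    by_cases hxU : x ∈ closure U
    · rw [hgU x hxU, hφ0 (hdiff ▸ ⟨hxU, hx.2⟩ : x ∈ closure U \ U), Pi.zero_apply, zero_smul]
    · exact if_neg hxU
  have hgc : ContinuousOn g Y := by
    refine ContinuousOn.mono (s := closure U ∪ Y ∩ Vᶜ) (.union_of_isClosed ?_ ?_ isClosed_closure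
      (hY.inter hV.isClosed_compl)) fun x hx => ?_
    · exact (φ.continuous.continuousOn.smul hfc).congr hgU
    · exact continuousOn_const.congr hgV
    · by_cases hxV : x ∈ V
      · exact Or.inl (subset_closure (hU ▸ ⟨hxV, hx⟩))
      · exact Or.inr ⟨hx, hxV⟩
  let C : Set E := closure (convexHull ℝ (insert 0 K))
  have hsub : insert 0 K ⊆ C := (subset_convexHull ℝ _).trans subset_closure
  have hCconv : Convex ℝ C := (convex_convexHull ℝ _).closure
  have hCcomp : IsCompact C :=
    (totallyBounded_convexHull.2 (hK.insert 0).totallyBounded).closure.isCompact_of_isClosed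
      isClosed_closure
  have hCY : C ⊆ Y := closure_minimal
    (convexHull_min (Set.insert_subset h0Y hKY) hYconv) hY
  have h0C : (0 : E) ∈ C := hsub (Set.mem_insert _ _)
  have hgC : Set.MapsTo g C C := by
    intro x _
    by_cases hxU : x ∈ closure U
    · rw [hgU x hxU]
      exact hCconv.smul_mem_of_zero_mem h0C (hsub (Set.mem_insert_of_mem _ (hf hxU))) (hφ x)
    · simpa only [g, if_neg hxU] using h0C
  obtain ⟨x, -, hgx⟩ := exists_fixedPoint_of_isCompact_convex hCcomp hCconv ⟨0, h0C⟩
    (hgc.mono hCY) hgC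
  by_cases hxU : x ∈ closure U
  · rw [hgU x hxU] at hgx
    have hxA : x ∈ A := ⟨(⟨φ x, hφ x⟩, x), ⟨hxU, sub_eq_zero.2 hgx.symm⟩, rfl⟩
    rw [hφ1 hxA, Pi.one_apply, one_smul] at hgx
    exact hno x hxU hgx
  · have : x = 0 := hgx.symm.trans (if_neg hxU)
    exact hxU (this ▸ subset_closure h0)

end FixedPoint

/-- Fixed point theorem for the sum of an expansion `T x = η • x` (η > 1) and a map `S`
whose complement `I - S` maps the closure of `U` into a compact subset of a closed
convex set `Y`.  `U` is open in the subspace topology of `Y` and contains `0`; since `U`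
is open in `Y` and `Y` is closed, the closure and the boundary of `U` relative to `Y`
are `closure U` and `closure U \ U` respectively. -/
theorem fixed_point_expansive_plus_compact
    {E : Type*} [NormedAddCommGroup E] [NormedSpace ℝ E] [CompleteSpace E]
    (Y : Set E) (hYclosed : IsClosed Y) (hYconv : Convex ℝ Y)
    (U : Set E) (hUY : U ⊆ Y)
    (hUopen : ∃ V : Set E, IsOpen V ∧ U = V ∩ Y)
    (h0U : (0 : E) ∈ U)
    (η : ℝ) (hη : 1 < η)
    (S : E → E) (hScont : ContinuousOn S (closure U))
    (hcomp : ∃ K : Set E, IsCompact K ∧ K ⊆ Y ∧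
      (fun x => x - S x) '' (closure U) ⊆ K)
    (hbd : ∀ x ∈ closure U \ U, ∀ lam : ℝ, 0 < lam → lam < 1 / η →
      x ≠ lam • (x - S x)) :
    ∃ x ∈ closure U, η • x + S x = x := by
  obtain ⟨V, hV, hU⟩ := hUopen
  obtain ⟨K, hK, hKY, hSK⟩ := hcomp
  have hη0 : 0 < η := one_pos.trans hη
  have h0Y : (0 : E) ∈ Y := hUY h0U
  have hmaps : Set.MapsTo (fun x => η⁻¹ • (x - S x)) (closure U) ((fun y => η⁻¹ • y) '' K) :=
    fun x hx => Set.mem_image_of_mem _ (hSK (Set.mem_image_of_mem _ hx))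
  have hsmulK : (fun y => η⁻¹ • y) '' K ⊆ Y := by
    rintro _ ⟨y, hy, rfl⟩
    exact hYconv.smul_mem_of_zero_mem h0Y (hKY hy)
      ⟨(inv_pos.2 hη0).le, inv_le_one_of_one_le₀ hη.le⟩
  rcases exists_fixedPoint_or_exists_eq_smul (f := fun x => η⁻¹ • (x - S x))
      hYclosed hYconv hV hU h0U (hK.image (continuous_const_smul η⁻¹)) hsmulK
      ((continuousOn_id.sub hScont).const_smul η⁻¹) hmaps with
    ⟨x, hx, hfx⟩ | ⟨x, hx, t, ht0, ht1, hxt⟩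
  · refine ⟨x, hx, ?_⟩
    rw [inv_smul_eq_iff₀ hη0.ne'] at hfx
    rw [← hfx, sub_add_cancel]
  · rw [smul_smul] at hxt
    refine absurd hxt (hbd x hx (t * η⁻¹) (by positivity) ?_)
    rw [one_div]
    exact mul_lt_of_lt_one_left (inv_pos.2 hη0) ht1
end

section
/- There exist real numbers u₀, u₁, u₄, u₁₆, u₆₄, u₂₅₆ such that, setting D₀ = u₁ − u₀, D₁ = (u₄ − u₁)/3, D₄ = (u₁₆ − u₄)/12, D₁₆ = (u₆₄ − u₁₆)/48, D₆₄ = (u₂₅₆ − u₆₄)/192, and E₁ = (D₄ − D₁)/3, E₄ = (D₁₆ − D₄)/12, E₁₆ = (D₆₄ − D₁₆)/48, the following equations hold: E₁ + 1 + u₁/(100(1 + u₁²)) + D₁/(10(1 + D₁² + D₁⁴)) = 0; E₄ + 1 + u₄/(100(1 + u₄²)) + D₄/(10(1 + D₄² + D₄⁴)) = 0; E₁₆ + 1 + u₁₆/(100(1 + u₁₆²)) + D₁₆/(10(1 + D₁₆² + D₁₆⁴)) = 0; D₀ = 1/2 + u₀/(3(1 + u₀² + u₀⁴)) + u₀²/(4(1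 + u₀²)); u₁ = 0; and u₂₅₆ = 0. -/
theorem exists_shooting_parameter {F : ℝ → ℝ → ℝ} (hF : Continuous fun p : ℝ × ℝ => F p.1 p.2)
    (h_nonneg : ∀ x y, 0 ≤ F x y) (h_le : ∀ x y, F x y ≤ 2) :
    ∃ u₄ u₁₆ u₆₄ D₁ D₄ D₁₆ D₆₄ : ℝ,
      u₄ = 3 * D₁ ∧ u₁₆ = u₄ + 12 * D₄ ∧ u₆₄ = u₁₆ + 48 * D₁₆ ∧ 0 = u₆₄ + 192 * D₆₄ ∧
      D₄ = D₁ - 3 * F 0 D₁ ∧ D₁₆ = D₄ - 12 * F u₄ D₄ ∧ D₆₄ = D₁₆ - 48 * F u₁₆ D₁₆ := by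
  let D₄ : ℝ → ℝ := fun d => d - 3 * F 0 d
  let D₁₆ : ℝ → ℝ := fun d => D₄ d - 12 * F (3 * d) (D₄ d)
  let u₁₆ : ℝ → ℝ := fun d => 3 * d + 12 * D₄ d
  let D₆₄ : ℝ → ℝ := fun d => D₁₆ d - 48 * F (u₁₆ d) (D₁₆ d)
  have hcomp {a b : ℝ → ℝ} (ha : Continuous a) (hb : Continuous b) :
      Continuous fun d => F (a d) (b d) := hF.comp (ha.prodMk hb)
  have hD₄ : Continuous D₄ :=
    continuous_id.sub (continuous_const.mul (hcomp continuous_const continuous_id))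
  have hD₁₆ : Continuous D₁₆ :=
    hD₄.sub (continuous_const.mul (hcomp (continuous_const.mul continuous_id) hD₄))
  have hu₁₆ : Continuous u₁₆ := by fun_prop
  have hD₆₄ : Continuous D₆₄ := hD₁₆.sub (continuous_const.mul (hcomp hu₁₆ hD₁₆))
  have hu : Continuous fun d => u₁₆ d + 48 * D₁₆ d + 192 * D₆₄ d := by fun_prop
  obtain ⟨d, hd⟩ := mem_range_of_exists_le_of_exists_ge (c := 0) hu
    ⟨0, by
      have hF₁ := h_nonneg 0 0
      have hF₂ := h_nonneg (3 * 0) (D₄ 0)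
      have hF₃ := h_nonneg (u₁₆ 0) (D₁₆ 0)
      have e₁ : D₄ 0 = 0 - 3 * F 0 0 := rfl
      have e₂ : D₁₆ 0 = D₄ 0 - 12 * F (3 * 0) (D₄ 0) := rfl
      have e₃ : u₁₆ 0 = 3 * 0 + 12 * D₄ 0 := rfl
      have e₄ : D₆₄ 0 = D₁₆ 0 - 48 * F (u₁₆ 0) (D₁₆ 0) := rfl
      clear_value D₆₄ u₁₆ D₁₆ D₄
      linarith⟩
    ⟨200, by
      have hF₁ := h_le 0 200
      have hF₂ := h_le (3 * 200) (D₄ 200)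
      have hF₃ := h_le (u₁₆ 200) (D₁₆ 200)
      have e₁ : D₄ 200 = 200 - 3 * F 0 200 := rfl
      have e₂ : D₁₆ 200 = D₄ 200 - 12 * F (3 * 200) (D₄ 200) := rfl
      have e₃ : u₁₆ 200 = 3 * 200 + 12 * D₄ 200 := rfl
      have e₄ : D₆₄ 200 = D₁₆ 200 - 48 * F (u₁₆ 200) (D₁₆ 200) := rfl
      clear_value D₆₄ u₁₆ D₁₆ D₄
      linarith⟩
  exact ⟨3 * d, u₁₆ d, u₁₆ d + 48 * D₁₆ d, d, D₄ d, D₁₆ d, D₆₄ d,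
    rfl, rfl, rfl, hd.symm, rfl, rfl, rfl⟩

theorem abs_div_mul_one_add_sq_le (x : ℝ) : |x / (100 * (1 + x ^ 2))| ≤ 1 / 4 := by
  rw [abs_le, le_div_iff₀ (by positivity), div_le_iff₀ (by positivity)]
  constructor <;> nlinarith [sq_nonneg (x + 1), sq_nonneg (x - 1)]

theorem abs_div_mul_one_add_sq_add_pow_four_le (y : ℝ) :
    |y / (10 * (1 + y ^ 2 + y ^ 4))| ≤ 1 / 4 := by
  have : 0 ≤ y ^ 4 := by positivity
  rw [abs_le, le_div_iff₀ (by positivity), div_le_iff₀ (by positivity)]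
  constructor <;> nlinarith [sq_nonneg (y + 1), sq_nonneg (y - 1)]

theorem exists_initial_value :
    ∃ x : ℝ, 0 - x = 1 / 2 + x / (3 * (1 + x ^ 2 + x ^ 4)) + x ^ 2 / (4 * (1 + x ^ 2)) := by
  have hc : Continuous fun x : ℝ =>
      x + (1 / 2 + x / (3 * (1 + x ^ 2 + x ^ 4)) + x ^ 2 / (4 * (1 + x ^ 2))) := by
    fun_prop (disch := intro; positivity)
  obtain ⟨x, hx⟩ := mem_range_of_exists_le_of_exists_ge (c := 0) hc
    ⟨-2, by norm_num⟩ ⟨0, by norm_num⟩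
  exact ⟨x, by linarith⟩

/-- Existence of at least one solution to the example boundary value problem of the
paper on the time scale `{0} ∪ {4^k}` with `T = 256`, written out explicitly at the
points `0, 1, 4, 16, 64, 256`. -/
theorem example_bvp_has_solution :
    ∃ u₀ u₁ u₄ u₁₆ u₆₄ u₂₅₆ D₀ D₁ D₄ D₁₆ D₆₄ E₁ E₄ E₁₆ : ℝ,
      D₀ = u₁ - u₀ ∧
      D₁ = (u₄ - u₁) / 3 ∧
      D₄ = (u₁₆ - u₄) / 12 ∧
      D₁₆ = (u₆₄ - u₁₆) / 48 ∧
      D₆₄ = (u₂₅₆ - u₆₄) / 192 ∧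
      E₁ = (D₄ - D₁) / 3 ∧
      E₄ = (D₁₆ - D₄) / 12 ∧
      E₁₆ = (D₆₄ - D₁₆) / 48 ∧
      E₁ + 1 + u₁ / (100 * (1 + u₁ ^ 2)) + D₁ / (10 * (1 + D₁ ^ 2 + D₁ ^ 4)) = 0 ∧
      E₄ + 1 + u₄ / (100 * (1 + u₄ ^ 2)) + D₄ / (10 * (1 + D₄ ^ 2 + D₄ ^ 4)) = 0 ∧
      E₁₆ + 1 + u₁₆ / (100 * (1 + u₁₆ ^ 2)) + D₁₆ / (10 * (1 + D₁₆ ^ 2 + D₁₆ ^ 4)) = 0 ∧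
      D₀ = 1 / 2 + u₀ / (3 * (1 + u₀ ^ 2 + u₀ ^ 4)) + u₀ ^ 2 / (4 * (1 + u₀ ^ 2)) ∧
      u₁ = 0 ∧
      u₂₅₆ = 0 := by
  obtain ⟨u₀, hu₀⟩ := exists_initial_value
  let F : ℝ → ℝ → ℝ := fun x y =>
    1 + x / (100 * (1 + x ^ 2)) + y / (10 * (1 + y ^ 2 + y ^ 4))
  have hF : Continuous fun p : ℝ × ℝ => F p.1 p.2 := by
    simp only [F]
    fun_prop (disch := intro; positivity)
  have hbound (x y : ℝ) : 0 ≤ F x y ∧ F x y ≤ 2 := by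
    have hx := abs_le.mp (abs_div_mul_one_add_sq_le x)
    have hy := abs_le.mp (abs_div_mul_one_add_sq_add_pow_four_le y)
    constructor <;> simp only [F] <;> linarith [hx.1, hx.2, hy.1, hy.2]
  obtain ⟨u₄, u₁₆, u₆₄, D₁, D₄, D₁₆, D₆₄, h₄, h₁₆, h₆₄, h₂₅₆, hD₄, hD₁₆, hD₆₄⟩ :=
    exists_shooting_parameter hF (fun x y => (hbound x y).1) (fun x y => (hbound x y).2)
  simp only [F] at hD₄ hD₁₆ hD₆₄
  refine ⟨u₀, 0, u₄, u₁₆, u₆₄, 0, 0 - u₀, D₁, D₄, D₁₆, D₆₄, (D₄ - D₁) / 3, (D₁₆ - D₄) / 12,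
    (D₆₄ - D₁₆) / 48, rfl, ?_, ?_, ?_, ?_, rfl, rfl, rfl, ?_, ?_, ?_, hu₀, rfl, rfl⟩ <;>
    linarith
end
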